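/- Let ω be a weight function with constant K, g ∈ 𝒮_ω(ℝᴺ) nonzero, α > N/2, z̄ = (x̄, ξ̄) ∈ ℝ^{2N}, and E ⊂ ℝ^{2N} measurable. For every λ ≥ 0 there exists C_λ > 0 such that for every μ ≥ 0 and f ∈ 𝒮_ω(ℝᴺ): ∫_E e^{λω(x,ξ)} |Sp_g f(x,ξ)| dx dξ ≤ C_λ · D′_μ(E) · ‖e^{λ′ω} f‖₂^{1−N/(2α)} ‖e^{λ′ω} |x−x̄|^α f‖₂^{N/(2α)} ‖e^{λ′ω} f̂‖₂^{1−N/(2α)} ‖e^{λ′ω} |ξ−ξ̄|^α f̂‖₂^{N/(2α)}, where λ′ = K²(λ+μ) and D′_μ(E) = ∫_E e^{−μω(x,ξ)} dx dξ. -/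

import Mathlib

open MeasureTheory Complex ENNReal

noncomputable section

abbrev RN (N : ℕ) := Fin N → ℝ

def dotR {N : ℕ} (x y : RN N) : ℝ := ∑ i, x i * y i

def stft {N : ℕ} (g f : RN N → ℂ) (x ξ : RN N) : ℂ :=
  ∫ y, f y * (starRingEnd ℂ) (g (y - x)) * Complex.exp (-(Complex.I * (dotR y ξ : ℂ)))

def ftr {N : ℕ} (f : RN N → ℂ) (ξ : RN N) : ℂ :=
  ∫ x, Complex.exp (-(Complex.I * (dotR x ξ : ℂ))) * f x

def rihaczek {N : ℕ} (f : RN N → ℂ) (x ξ : RN N) : ℂ :=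
  Complex.exp (-(Complex.I * (dotR x ξ : ℂ))) * f x * (starRingEnd ℂ) (ftr f ξ)

def spec {N : ℕ} (g f : RN N → ℂ) (x ξ : RN N) : ℝ := ‖stft g f x ξ‖ ^ 2

def wig {N : ℕ} (τ : ℝ) (f : RN N → ℂ) (x ξ : RN N) : ℂ :=
  ∫ t, Complex.exp (-(Complex.I * (dotR t ξ : ℂ))) * f (x + τ • t) *
    (starRingEnd ℂ) (f (x - (1 - τ) • t))

structure WeightFunction where
  w : ℝ → ℝ
  K : ℝ
  a : ℝ
  b : ℝ
  oneLeK : 1 ≤ K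
  bpos : 0 < b
  cont : Continuous w
  mono : MonotoneOn w (Set.Ici 0)
  nonneg : ∀ t, 0 ≤ w t
  alpha : ∀ t, 0 ≤ t → w (2 * t) ≤ K * (1 + w t)
  beta : Filter.Tendsto (fun t => w t / t) Filter.atTop (nhds 0)
  gamma : ∀ t, 0 ≤ t → a + b * Real.log (1 + t) ≤ w t
  delta : ConvexOn ℝ Set.univ (fun t => w (Real.exp t))
  subadd : ∀ s t, 0 ≤ s → 0 ≤ t → w (s + t) ≤ K * (1 + w s + w t)

def wnorm (W : WeightFunction) (lam : ℝ) {E : Type*} [NormedAddCommGroup E]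
    [MeasurableSpace E] (μ : Measure E) {F : Type*} [NormedAddCommGroup F]
    (f : E → F) (p : ℝ≥0∞) : ℝ≥0∞ :=
  eLpNorm (fun t => Real.exp (lam * W.w ‖t‖) * ‖f t‖) p μ

def SOmega {N : ℕ} (W : WeightFunction) (f : RN N → ℂ) : Prop :=
  ∀ lam : ℝ, 0 < lam →
    (∃ C, ∀ x, Real.exp (lam * W.w ‖x‖) * ‖f x‖ ≤ C) ∧
    (∃ C, ∀ ξ, Real.exp (lam * W.w ‖ξ‖) * ‖ftr f ξ‖ ≤ C)

def elpN {α : Type*} [MeasurableSpace α] (μ : Measure α) (h : α → ℝ≥0∞) (p : ℝ≥0∞) : ℝ≥0∞ :=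
  if p = ∞ then essSup h μ else (∫⁻ z, (h z) ^ p.toReal ∂μ) ^ (1 / p.toReal)

end

lemma WeightFunction.integrable_exp_neg (W : WeightFunction) {E : Type*} [NormedAddCommGroup E]
    [NormedSpace ℝ E] [FiniteDimensional ℝ E] [MeasurableSpace E] [BorelSpace E]
    (m : Measure E) [m.IsAddHaarMeasure] {κ : ℝ} (hκ : (Module.finrank ℝ E : ℝ) < κ * W.b) :
    Integrable (fun x => Real.exp (-(κ * W.w ‖x‖))) m := by
  have hκ0 : 0 < κ := by
    have h : 0 < κ * W.b := lt_of_le_of_lt (Nat.cast_nonneg _) hκ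
    exact (pos_iff_pos_of_mul_pos h).2 W.bpos
  have hcont := W.cont
  refine ((integrable_one_add_norm (μ := m) hκ).const_mul (Real.exp (-(κ * W.a)))).mono'
    (by fun_prop) (Filter.Eventually.of_forall fun x => ?_)
  have hx : 0 < 1 + ‖x‖ := by positivity
  rw [Real.norm_eq_abs, abs_of_pos (Real.exp_pos _), Real.rpow_def_of_pos hx, ← Real.exp_add]
  refine Real.exp_le_exp.2 ?_
  have := mul_le_mul_of_nonneg_left (W.gamma ‖x‖ (norm_nonneg x)) hκ0.le
  linarith

lemma WeightFunction.integrable_exp_mul_norm (W : WeightFunction) {E : Type*}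
    [NormedAddCommGroup E] [NormedSpace ℝ E] [FiniteDimensional ℝ E] [MeasurableSpace E]
    [BorelSpace E] (m : Measure E) [m.IsAddHaarMeasure] {h : E → ℂ} (hc : Continuous h)
    (hb : ∀ κ : ℝ, 0 < κ → ∃ C, ∀ x, Real.exp (κ * W.w ‖x‖) * ‖h x‖ ≤ C)
    {ν : ℝ} (hν : 0 ≤ ν) :
    Integrable (fun x => Real.exp (ν * W.w ‖x‖) * ‖h x‖) m := by
  have hcont := W.cont
  have hbpos := W.bpos
  set κ : ℝ := (Module.finrank ℝ E + 1) / W.b with hκ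
  have hκ0 : 0 < κ := by positivity
  obtain ⟨C, hC⟩ := hb (ν + κ) (by positivity)
  have hi := W.integrable_exp_neg m (κ := κ) (by rw [hκ]; field_simp; linarith)
  refine (hi.const_mul C).mono' (by fun_prop) (Filter.Eventually.of_forall fun x => ?_)
  rw [Real.norm_eq_abs, abs_of_nonneg (by positivity)]
  calc Real.exp (ν * W.w ‖x‖) * ‖h x‖
      = (Real.exp ((ν + κ) * W.w ‖x‖) * ‖h x‖) * Real.exp (-(κ * W.w ‖x‖)) := by
        rw [mul_right_comm, ← Real.exp_add]; ring_nf
    _ ≤ C * Real.exp (-(κ * W.w ‖x‖)) := by gcongr; exact hC x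

lemma norm_exp_neg_I_mul (t : ℝ) : ‖Complex.exp (-(Complex.I * (t : ℂ)))‖ = 1 := by
  rw [Complex.norm_exp]; simp

lemma continuous_dotR {N : ℕ} : Continuous fun p : RN N × RN N => dotR p.1 p.2 := by
  unfold dotR; fun_prop

lemma dotR_add {N : ℕ} (x y z : RN N) : dotR x (y + z) = dotR x y + dotR x z := by
  simp [dotR, mul_add, Finset.sum_add_distrib]

lemma dotR_sub {N : ℕ} (x y z : RN N) : dotR x (y - z) = dotR x y - dotR x z := by
  simp [dotR, mul_sub, Finset.sum_sub_distrib]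

lemma dotR_add_left {N : ℕ} (x y z : RN N) : dotR (x + y) z = dotR x z + dotR y z := by
  simp [dotR, add_mul, Finset.sum_add_distrib]

lemma dotR_smul {N : ℕ} (c : ℝ) (x y : RN N) : dotR x (c • y) = c * dotR x y := by
  simp only [dotR, Finset.mul_sum, Pi.smul_apply, smul_eq_mul]
  exact Finset.sum_congr rfl fun i _ => by ring

lemma continuous_ftr {N : ℕ} {f : RN N → ℂ} (hf : Integrable f) : Continuous (ftr f) := by
  refine continuous_of_dominated (bound := fun x => ‖f x‖) (fun ξ => ?_) (fun ξ => ?_) hf.norm ?_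
  · refine AEStronglyMeasurable.mul ?_ hf.1
    have := continuous_dotR (N := N)
    exact (Continuous.aestronglyMeasurable (by fun_prop))
  · exact Filter.Eventually.of_forall fun x => by rw [norm_mul, norm_exp_neg_I_mul, one_mul]
  · refine Filter.Eventually.of_forall fun x => ?_
    have := continuous_dotR (N := N)
    fun_prop

lemma ftr_eq_fourier {N : ℕ} (f : RN N → ℂ) (w : EuclideanSpace ℝ (Fin N)) :
    FourierTransform.fourier (fun v : EuclideanSpace ℝ (Fin N) => f v.ofLp) w =
      ftr f ((2 * Real.pi) • w.ofLp) := by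
  rw [Real.fourier_eq', ftr, ← (PiLp.volume_preserving_ofLp (Fin N)).integral_comp
    (MeasurableEquiv.toLp 2 (Fin N → ℝ)).symm.measurableEmbedding]
  refine integral_congr_ae (Filter.Eventually.of_forall fun v => ?_)
  have : inner ℝ v w = dotR v.ofLp w.ofLp := by
    rw [PiLp.inner_apply, dotR]
    exact Finset.sum_congr rfl fun i _ => by simp [mul_comm]
  simp only [smul_eq_mul, dotR_smul, this]
  congr 2
  push_cast; ring

/-- Fourier inversion for the normalisation `ftr`. -/
lemma ftr_inversion {N : ℕ} {f : RN N → ℂ} (hc : Continuous f) (hf : Integrable f)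
    (hF : Integrable (ftr f)) (y : RN N) :
    f y = (((2 * Real.pi) ^ N)⁻¹ : ℝ) * ∫ η, ftr f η * Complex.exp (Complex.I * (dotR y η : ℂ)) := by
  have hmp := PiLp.volume_preserving_ofLp (Fin N)
  have hme := (MeasurableEquiv.toLp 2 (Fin N → ℝ)).symm.measurableEmbedding
  have h2 : (2 * Real.pi) ≠ 0 := by positivity
  set φ : EuclideanSpace ℝ (Fin N) → ℂ := fun v => f v.ofLp with hφ
  have hφc : Continuous φ := hc.comp (PiLp.continuous_ofLp 2 _)
  have hφi : Integrable φ := (hmp.integrable_comp_emb hme).2 hf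
  have hFφ : FourierTransform.fourier φ = fun w => ftr f ((2 * Real.pi) • w.ofLp) :=
    funext fun w => ftr_eq_fourier f w
  have hφF : Integrable (FourierTransform.fourier φ) := by
    rw [hFφ]
    exact (hmp.integrable_comp_emb hme (g := fun v => ftr f ((2 * Real.pi) • v))).2
      (hF.comp_smul h2)
  have key := congrFun (hφc.fourierInv_fourier_eq hφi hφF) (WithLp.toLp 2 y)
  have key2 : f y = FourierTransformInv.fourierInv (FourierTransform.fourier φ) (WithLp.toLp 2 y) := by
    rw [key]
  rw [key2, Real.fourierInv_eq', hFφ]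
  have h3 := Measure.integral_comp_smul (volume : Measure (RN N))
    (fun η => ftr f η * Complex.exp (Complex.I * (dotR y η : ℂ))) (2 * Real.pi)
  rw [abs_of_nonneg (by positivity), Module.finrank_fin_fun] at h3
  rw [← Complex.real_smul, ← h3, ← hmp.integral_comp hme]
  refine integral_congr_ae (Filter.Eventually.of_forall fun v => ?_)
  have : inner ℝ v (WithLp.toLp 2 y) = dotR y v.ofLp := by
    rw [PiLp.inner_apply, dotR]
    exact Finset.sum_congr rfl fun i _ => by simp
  simp only [smul_eq_mul, dotR_smul, this]
  rw [mul_comm]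
  congr 2
  push_cast; ring

lemma norm_stft_le {N : ℕ} (g f : RN N → ℂ) (x ξ : RN N) :
    ‖stft g f x ξ‖ ≤ ∫ y, ‖f y‖ * ‖g (y - x)‖ := by
  refine (norm_integral_le_integral_norm _).trans_eq ?_
  refine integral_congr_ae (Filter.Eventually.of_forall fun y => ?_)
  simp only [norm_mul, norm_exp_neg_I_mul, mul_one, RCLike.norm_conj]

lemma norm_integral_conj_translate {N : ℕ} (g : RN N → ℂ) (x ξ η : RN N) :
    ‖∫ y, Complex.exp (Complex.I * (dotR y η : ℂ)) * ((starRingEnd ℂ) (g (y - x)) *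
      Complex.exp (-(Complex.I * (dotR y ξ : ℂ))))‖ = ‖ftr g (η - ξ)‖ := by
  have h1 : ∀ y, Complex.exp (Complex.I * (dotR y η : ℂ)) * ((starRingEnd ℂ) (g (y - x)) *
      Complex.exp (-(Complex.I * (dotR y ξ : ℂ)))) =
      (starRingEnd ℂ) (Complex.exp (-(Complex.I * (dotR x (η - ξ) : ℂ))) *
        (Complex.exp (-(Complex.I * (dotR (y - x) (η - ξ) : ℂ))) * g (y - x))) := by
    intro y
    have h2 : dotR y (η - ξ) = dotR (y - x) (η - ξ) + dotR x (η - ξ) := by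
      rw [← dotR_add_left, sub_add_cancel]
    rw [mul_left_comm, ← Complex.exp_add, ← mul_assoc, ← Complex.exp_add, map_mul,
      ← Complex.exp_conj, mul_comm]
    rw [dotR_sub y] at h2
    have h3 := congrArg (fun t : ℝ => (t : ℂ)) h2
    push_cast at h3
    congr 2
    simp only [map_add, map_neg, map_mul, Complex.conj_I, Complex.conj_ofReal]
    linear_combination Complex.I * h3
  simp only [h1]
  rw [integral_conj, RCLike.norm_conj, integral_const_mul, norm_mul, norm_exp_neg_I_mul, one_mul]
  rw [integral_sub_right_eq_self
    (fun y => Complex.exp (-(Complex.I * (dotR y (η - ξ) : ℂ))) * g y) x]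
  rfl

/-- The short-time Fourier transform is bounded by a convolution on the frequency side. -/
lemma norm_stft_le_ftr {N : ℕ} {g f : RN N → ℂ} (hg : Integrable g) (hc : Continuous f)
    (hf : Integrable f) (hF : Integrable (ftr f)) (x ξ : RN N) :
    ‖stft g f x ξ‖ ≤ ((2 * Real.pi) ^ N)⁻¹ * ∫ η, ‖ftr f η‖ * ‖ftr g (η - ξ)‖ := by
  have hdot := continuous_dotR (N := N)
  set c : ℂ := ((((2 * Real.pi) ^ N)⁻¹ : ℝ) : ℂ) with hcdef
  have h1 : stft g f x ξ = c * ∫ y, ∫ η, ftr f η * (Complex.exp (Complex.I * (dotR y η : ℂ)) *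
      ((starRingEnd ℂ) (g (y - x)) * Complex.exp (-(Complex.I * (dotR y ξ : ℂ))))) := by
    rw [stft, ← integral_const_mul]
    refine integral_congr_ae (Filter.Eventually.of_forall fun y => ?_)
    simp only
    rw [ftr_inversion hc hf hF y, mul_assoc, mul_assoc, ← integral_mul_const]
    congr 1
    refine integral_congr_ae (Filter.Eventually.of_forall fun η => ?_)
    simp only
    ring
  have hint : Integrable (fun p : RN N × RN N => ftr f p.2 *
      (Complex.exp (Complex.I * (dotR p.1 p.2 : ℂ)) *
      ((starRingEnd ℂ) (g (p.1 - x)) * Complex.exp (-(Complex.I * (dotR p.1 ξ : ℂ))))))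
      (volume.prod volume) := by
    have h2 : Integrable (fun p : RN N × RN N => (starRingEnd ℂ) (g (p.1 - x)) * ftr f p.2)
        (volume.prod volume) :=
      Integrable.mul_prod (f := fun y => (starRingEnd ℂ) (g (y - x)))
        ((Complex.conjLIE.toContinuousLinearEquiv.toContinuousLinearMap).integrable_comp
          (hg.comp_sub_right x)) hF
    have h3 : Continuous fun p : RN N × RN N => Complex.exp (Complex.I * (dotR p.1 p.2 : ℂ)) *
      Complex.exp (-(Complex.I * (dotR p.1 ξ : ℂ))) := by fun_prop
    refine (h2.bdd_mul (c := 1) h3.aestronglyMeasurable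
      (Filter.Eventually.of_forall fun p => ?_)).congr (Filter.Eventually.of_forall fun p => ?_)
    · rw [norm_mul, norm_exp_neg_I_mul, Complex.norm_exp]; simp
    · simp only
      ring
  rw [h1, integral_integral_swap hint, norm_mul]
  refine mul_le_mul (by rw [hcdef, Complex.norm_real, Real.norm_eq_abs,
    abs_of_nonneg (by positivity)]) ?_ (norm_nonneg _) (by positivity)
  refine (norm_integral_le_integral_norm _).trans_eq ?_
  refine integral_congr_ae (Filter.Eventually.of_forall fun η => ?_)
  simp only
  rw [integral_const_mul, norm_mul, norm_integral_conj_translate]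

lemma WeightFunction.exp_le (W : WeightFunction) {E : Type*} [NormedAddCommGroup E]
    {κ : ℝ} (hκ : 0 ≤ κ) (x y : E) :
    Real.exp (κ * W.w ‖x‖) ≤ Real.exp (κ * W.K) * Real.exp (κ * W.K * W.w ‖y‖) *
      Real.exp (κ * W.K * W.w ‖y - x‖) := by
  rw [← Real.exp_add, ← Real.exp_add]
  refine Real.exp_le_exp.2 ?_
  have h1 : ‖x‖ ≤ ‖y‖ + ‖y - x‖ := by
    have := norm_sub_le y (y - x)
    simpa using this
  have h2 : W.w ‖x‖ ≤ W.w (‖y‖ + ‖y - x‖) :=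
    W.mono (norm_nonneg _) (Set.mem_Ici.2 (by positivity)) h1
  have h3 := W.subadd ‖y‖ ‖y - x‖ (norm_nonneg _) (norm_nonneg _)
  have h4 := mul_le_mul_of_nonneg_left (h2.trans h3) hκ
  linarith

/-- Weighted convolution bound. -/
lemma WeightFunction.exp_mul_integral_le (W : WeightFunction) {N : ℕ} {u v : RN N → ℂ}
    {κ C : ℝ} (hκ : 0 ≤ κ)
    (hu : Integrable fun y => Real.exp (κ * W.K * W.w ‖y‖) * ‖u y‖)
    (hv : ∀ y, Real.exp (κ * W.K * W.w ‖y‖) * ‖v y‖ ≤ C) (x : RN N) :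
    Real.exp (κ * W.w ‖x‖) * ∫ y, ‖u y‖ * ‖v (y - x)‖ ≤
      Real.exp (κ * W.K) * C * ∫ y, Real.exp (κ * W.K * W.w ‖y‖) * ‖u y‖ := by
  rw [← integral_const_mul, ← integral_const_mul]
  refine integral_mono_of_nonneg (Filter.Eventually.of_forall fun y => by positivity)
    (hu.const_mul _) (Filter.Eventually.of_forall fun y => ?_)
  simp only
  calc Real.exp (κ * W.w ‖x‖) * (‖u y‖ * ‖v (y - x)‖)
      ≤ (Real.exp (κ * W.K) * Real.exp (κ * W.K * W.w ‖y‖) *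
          Real.exp (κ * W.K * W.w ‖y - x‖)) * (‖u y‖ * ‖v (y - x)‖) := by
        gcongr; exact W.exp_le hκ x y
    _ = Real.exp (κ * W.K) * (Real.exp (κ * W.K * W.w ‖y - x‖) * ‖v (y - x)‖) *
          (Real.exp (κ * W.K * W.w ‖y‖) * ‖u y‖) := by ring
    _ ≤ Real.exp (κ * W.K) * C * (Real.exp (κ * W.K * W.w ‖y‖) * ‖u y‖) := by
        gcongr; exact hv _

/-- The weighted `L¹` norm. -/
noncomputable def wInt {N : ℕ} (W : WeightFunction) (ν : ℝ) (f : RN N → ℂ) : ℝ :=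
  ∫ x, Real.exp (ν * W.w ‖x‖) * ‖f x‖

lemma wInt_nonneg {N : ℕ} (W : WeightFunction) (ν : ℝ) (f : RN N → ℂ) : 0 ≤ wInt W ν f :=
  integral_nonneg fun _ => by positivity

lemma wInt_mono {N : ℕ} (W : WeightFunction) {ν ν' : ℝ} (h : ν ≤ ν') {f : RN N → ℂ}
    (hf : Integrable fun x => Real.exp (ν' * W.w ‖x‖) * ‖f x‖) :
    wInt W ν f ≤ wInt W ν' f := by
  refine integral_mono_of_nonneg (Filter.Eventually.of_forall fun y => by positivity) hf
    (Filter.Eventually.of_forall fun y => ?_)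
  have := W.nonneg ‖y‖
  simp only
  gcongr

/-- A function with the regularity and decay properties of an element of the Beurling class. -/
structure BeurlingClass {N : ℕ} (W : WeightFunction) (f : RN N → ℂ) : Prop where
  continuous : Continuous f
  integrable : Integrable f
  continuous_ftr : Continuous (ftr f)
  integrable_ftr : Integrable (ftr f)
  bound : ∀ ν : ℝ, 0 ≤ ν → ∃ C, ∀ x, Real.exp (ν * W.w ‖x‖) * ‖f x‖ ≤ C
  bound_ftr : ∀ ν : ℝ, 0 ≤ ν → ∃ C, ∀ x, Real.exp (ν * W.w ‖x‖) * ‖ftr f x‖ ≤ C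
  weighted : ∀ ν : ℝ, 0 ≤ ν → Integrable fun x => Real.exp (ν * W.w ‖x‖) * ‖f x‖
  weighted_ftr : ∀ ν : ℝ, 0 ≤ ν → Integrable fun x => Real.exp (ν * W.w ‖x‖) * ‖ftr f x‖

lemma SOmega.beurlingClass {N : ℕ} {W : WeightFunction} {f : SchwartzMap (RN N) ℂ}
    (hf : SOmega W ⇑f) : BeurlingClass W ⇑f := by
  have hFc := _root_.continuous_ftr (f.integrable (μ := volume))
  have key : ∀ h : RN N → ℂ, (∀ ν : ℝ, 0 < ν → ∃ C, ∀ x, Real.exp (ν * W.w ‖x‖) * ‖h x‖ ≤ C) →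
      ∀ ν : ℝ, 0 ≤ ν → ∃ C, ∀ x, Real.exp (ν * W.w ‖x‖) * ‖h x‖ ≤ C := by
    intro h hh ν hν
    obtain ⟨C, hC⟩ := hh (ν + 1) (by positivity)
    refine ⟨C, fun x => le_trans ?_ (hC x)⟩
    have := W.nonneg ‖x‖
    gcongr
    linarith
  have hw := fun ν hν => W.integrable_exp_mul_norm (volume : Measure (RN N)) f.continuous
    (fun κ hκ => (hf κ hκ).1) (ν := ν) hν
  have hwF := fun ν hν => W.integrable_exp_mul_norm (volume : Measure (RN N)) hFc
    (fun κ hκ => (hf κ hκ).2) (ν := ν) hν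
  refine ⟨f.continuous, f.integrable, hFc, ?_, key _ fun κ hκ => (hf κ hκ).1,
    key _ fun κ hκ => (hf κ hκ).2, hw, hwF⟩
  have := hwF 0 le_rfl
  simp only [zero_mul, Real.exp_zero, one_mul] at this
  exact (integrable_norm_iff hFc.aestronglyMeasurable).1 this

lemma norm_le_integral_ftr {N : ℕ} {f : RN N → ℂ} (hc : Continuous f) (hf : Integrable f)
    (hF : Integrable (ftr f)) (y : RN N) :
    ‖f y‖ ≤ ((2 * Real.pi) ^ N)⁻¹ * ∫ η, ‖ftr f η‖ := by
  rw [ftr_inversion hc hf hF y, norm_mul, Complex.norm_real, Real.norm_eq_abs,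
    abs_of_nonneg (by positivity)]
  gcongr
  refine (norm_integral_le_integral_norm _).trans_eq ?_
  refine integral_congr_ae (Filter.Eventually.of_forall fun η => ?_)
  simp [Complex.norm_exp]

/-- Weighted pointwise bound for the spectrogram, uniform for bounded weights. -/
lemma BeurlingClass.exists_spec_le {N : ℕ} {W : WeightFunction} {g : RN N → ℂ}
    (hg : BeurlingClass W g) (κ₀ : ℝ) (hκ₀ : 0 ≤ κ₀) :
    ∃ C : ℝ, 0 ≤ C ∧ ∀ κ : ℝ, 0 ≤ κ → κ ≤ κ₀ → ∀ f : RN N → ℂ, BeurlingClass W f →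
      ∀ z : RN N × RN N, Real.exp (κ * W.w ‖z‖) * spec g f z.1 z.2 ≤
        C * (wInt W (W.K ^ 2 * κ) f * wInt W (W.K ^ 2 * κ) (ftr f)) := by
  have hK := W.oneLeK
  obtain ⟨G, hG⟩ := hg.bound (κ₀ * W.K) (by positivity)
  obtain ⟨H, hH⟩ := hg.bound_ftr (κ₀ * W.K) (by positivity)
  have hG0 : 0 ≤ G := le_trans (by positivity) (hG 0)
  have hH0 : 0 ≤ H := le_trans (by positivity) (hH 0)
  set c : ℝ := ((2 * Real.pi) ^ N)⁻¹ with hc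
  have hc0 : 0 ≤ c := by positivity
  set e := Real.exp (κ₀ * W.K) with he
  refine ⟨(e * G) * (c * (e * H)), by positivity, fun κ hκ hκκ f hf z => ?_⟩
  have hG' : ∀ κ' : ℝ, κ' ≤ κ₀ → ∀ y, Real.exp (κ' * W.K * W.w ‖y‖) * ‖g y‖ ≤ G := by
    intro κ' h y
    refine le_trans ?_ (hG y)
    have := W.nonneg ‖y‖
    gcongr
  have hH' : ∀ κ' : ℝ, κ' ≤ κ₀ → ∀ y, Real.exp (κ' * W.K * W.w ‖y‖) * ‖ftr g y‖ ≤ H := by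
    intro κ' h y
    refine le_trans ?_ (hH y)
    have := W.nonneg ‖y‖
    gcongr
  have hKK : κ * W.K ≤ W.K ^ 2 * κ := by nlinarith [mul_nonneg hκ (by linarith : 0 ≤ W.K)]
  have hA : ∀ κ', 0 ≤ κ' → κ' ≤ κ → Real.exp (κ' * W.w ‖z.1‖) * ‖stft g f z.1 z.2‖ ≤
      (e * G) * wInt W (W.K ^ 2 * κ) f := by
    intro κ' h0 h1
    calc Real.exp (κ' * W.w ‖z.1‖) * ‖stft g f z.1 z.2‖
        ≤ Real.exp (κ' * W.w ‖z.1‖) * ∫ y, ‖f y‖ * ‖g (y - z.1)‖ := by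
          gcongr; exact norm_stft_le _ _ _ _
      _ ≤ Real.exp (κ' * W.K) * G * wInt W (κ' * W.K) f :=
          W.exp_mul_integral_le h0 (hf.weighted _ (by positivity)) (hG' κ' (h1.trans hκκ)) _
      _ ≤ (e * G) * wInt W (W.K ^ 2 * κ) f := by
          have h2 : κ' * W.K ≤ κ * W.K := by gcongr
          have h3 : κ' ≤ κ₀ := h1.trans hκκ
          have := wInt_mono W (h2.trans hKK) (hf.weighted _ (by positivity))
          have := wInt_nonneg W (κ' * W.K) f
          rw [he]
          gcongr
  have hB : ∀ κ', 0 ≤ κ' → κ' ≤ κ → Real.exp (κ' * W.w ‖z.2‖) * ‖stft g f z.1 z.2‖ ≤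
      (c * (e * H)) * wInt W (W.K ^ 2 * κ) (ftr f) := by
    intro κ' h0 h1
    calc Real.exp (κ' * W.w ‖z.2‖) * ‖stft g f z.1 z.2‖
        ≤ Real.exp (κ' * W.w ‖z.2‖) * (c * ∫ y, ‖ftr f y‖ * ‖ftr g (y - z.2)‖) := by
          gcongr
          exact norm_stft_le_ftr hg.integrable hf.continuous hf.integrable hf.integrable_ftr _ _
      _ = c * (Real.exp (κ' * W.w ‖z.2‖) * ∫ y, ‖ftr f y‖ * ‖ftr g (y - z.2)‖) := by ring
      _ ≤ c * (Real.exp (κ' * W.K) * H * wInt W (κ' * W.K) (ftr f)) := by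
          refine mul_le_mul_of_nonneg_left ?_ hc0
          exact W.exp_mul_integral_le h0 (hf.weighted_ftr _ (by positivity))
            (hH' κ' (h1.trans hκκ)) _
      _ ≤ c * ((e * H) * wInt W (W.K ^ 2 * κ) (ftr f)) := by
          have h2 : κ' * W.K ≤ κ * W.K := by gcongr
          have h3 : κ' ≤ κ₀ := h1.trans hκκ
          have := wInt_mono W (h2.trans hKK) (hf.weighted_ftr _ (by positivity))
          have := wInt_nonneg W (κ' * W.K) (ftr f)
          rw [he]
          gcongr
      _ = _ := by ring
  have hA0 := hA 0 le_rfl hκ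
  have hB0 := hB 0 le_rfl hκ
  simp only [zero_mul, Real.exp_zero, one_mul] at hA0 hB0
  have hwA := wInt_nonneg W (W.K ^ 2 * κ) f
  have hwB := wInt_nonneg W (W.K ^ 2 * κ) (ftr f)
  rw [spec, sq, Prod.norm_def]
  rcases max_choice ‖z.1‖ ‖z.2‖ with h | h <;> rw [h]
  · calc Real.exp (κ * W.w ‖z.1‖) * (‖stft g f z.1 z.2‖ * ‖stft g f z.1 z.2‖)
        = (Real.exp (κ * W.w ‖z.1‖) * ‖stft g f z.1 z.2‖) * ‖stft g f z.1 z.2‖ := by ring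
      _ ≤ ((e * G) * wInt W (W.K ^ 2 * κ) f) * ((c * (e * H)) * wInt W (W.K ^ 2 * κ) (ftr f)) := by
          exact mul_le_mul (hA κ hκ le_rfl) hB0 (norm_nonneg _) (by positivity)
      _ = _ := by ring
  · calc Real.exp (κ * W.w ‖z.2‖) * (‖stft g f z.1 z.2‖ * ‖stft g f z.1 z.2‖)
        = ‖stft g f z.1 z.2‖ * (Real.exp (κ * W.w ‖z.2‖) * ‖stft g f z.1 z.2‖) := by ring
      _ ≤ ((e * G) * wInt W (W.K ^ 2 * κ) f) * ((c * (e * H)) * wInt W (W.K ^ 2 * κ) (ftr f)) := by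
          exact mul_le_mul hA0 (hB κ hκ le_rfl) (by positivity) (by positivity)
      _ = _ := by ring

lemma exists_polynomial_mul_pow_near_one (p : ℕ) {ε : ℝ} (hε : 0 < ε) :
    ∃ Q : Polynomial ℂ, ∀ v : ℂ, ‖1 - v‖ ≤ 1 / 2 → ‖1 - v ^ p * Q.eval v‖ ≤ ε := by
  have hcont : ContinuousAt (fun w : ℂ => 1 - (1 - w) ^ p) 0 := by fun_prop
  obtain ⟨δ, hδ, h⟩ := Metric.continuousAt_iff.1 hcont ε hε
  obtain ⟨n, hn⟩ := exists_pow_lt_of_lt_one hδ (by norm_num : (1 / 2 : ℝ) < 1)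
  obtain ⟨Q, hQ⟩ : (Polynomial.X : Polynomial ℂ) ∣ 1 - (1 - Polynomial.X) ^ n := by
    have := sub_dvd_pow_sub_pow (1 : Polynomial ℂ) (1 - Polynomial.X) n
    rwa [one_pow, show (1 : Polynomial ℂ) - (1 - Polynomial.X) = Polynomial.X by ring] at this
  refine ⟨Q ^ p, fun v hv => ?_⟩
  have h1 : v * Q.eval v = 1 - (1 - v) ^ n := by
    have := congrArg (Polynomial.eval v) hQ
    simpa using this.symm
  rw [Polynomial.eval_pow, ← mul_pow, h1]
  have h2 : ‖(1 - v) ^ n‖ < δ := by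
    rw [norm_pow]
    exact (pow_le_pow_left₀ (norm_nonneg _) hv n).trans_lt hn
  have h3 := h (x := (1 - v) ^ n) (by simpa using h2)
  simpa using h3.le

lemma ftr_shift_le {N : ℕ} (i : Fin N) (η : ℝ) (p : ℕ) (Q : Polynomial ℂ) {f : RN N → ℂ}
    (hf : Integrable f) (ξ : RN N) :
    ‖ftr f ξ‖ ≤ (∫ x, ‖1 - Complex.exp (-(Complex.I * ((η * x i : ℝ) : ℂ))) ^ p *
        Q.eval (Complex.exp (-(Complex.I * ((η * x i : ℝ) : ℂ))))‖ * ‖f x‖) +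
      ∑ j ∈ Finset.range (Q.natDegree + 1), ‖Q.coeff j‖ *
        ‖ftr f (ξ + Pi.single i (((p + j : ℕ) : ℝ) * η))‖ := by
  have hdot := continuous_dotR (N := N)
  set v : RN N → ℂ := fun x => Complex.exp (-(Complex.I * ((η * x i : ℝ) : ℂ))) with hv
  have hint : ∀ ζ : RN N,
      Integrable fun x => Complex.exp (-(Complex.I * (dotR x ζ : ℂ))) * f x := by
    intro ζ
    refine hf.bdd_mul (c := 1) (Continuous.aestronglyMeasurable (by fun_prop))
      (Filter.Eventually.of_forall fun x => by rw [norm_exp_neg_I_mul])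
  have hshift : ∀ (k : ℕ) x, Complex.exp (-(Complex.I *
      (dotR x (ξ + Pi.single i ((k : ℝ) * η)) : ℂ))) =
      Complex.exp (-(Complex.I * (dotR x ξ : ℂ))) * v x ^ k := by
    intro k x
    have : dotR x (Pi.single i ((k : ℝ) * η)) = k * (η * x i) := by
      rw [dotR, Finset.sum_eq_single i]
      · simp; ring
      · intro j _ hj
        simp [hj]
      · simp
    rw [dotR_add, this, hv, ← Complex.exp_nat_mul, ← Complex.exp_add]
    congr 1
    push_cast; ring
  have hmain : ftr f ξ = (∫ x, Complex.exp (-(Complex.I * (dotR x ξ : ℂ))) *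
      (1 - v x ^ p * Q.eval (v x)) * f x) +
      ∑ j ∈ Finset.range (Q.natDegree + 1), Q.coeff j *
        ftr f (ξ + Pi.single i (((p + j : ℕ) : ℝ) * η)) := by
    simp only [ftr]
    simp only [← integral_const_mul]
    rw [← integral_finsetSum _ fun j _ => (hint _).const_mul _]
    have hpt : ∀ x, Complex.exp (-(Complex.I * (dotR x ξ : ℂ))) *
        (1 - v x ^ p * Q.eval (v x)) * f x =
        Complex.exp (-(Complex.I * (dotR x ξ : ℂ))) * f x -
        ∑ j ∈ Finset.range (Q.natDegree + 1), Q.coeff j * (Complex.exp (-(Complex.I *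
          (dotR x (ξ + Pi.single i (((p + j : ℕ) : ℝ) * η)) : ℂ))) * f x) := by
      intro x
      have : ∑ j ∈ Finset.range (Q.natDegree + 1), Q.coeff j * (Complex.exp (-(Complex.I *
          (dotR x (ξ + Pi.single i (((p + j : ℕ) : ℝ) * η)) : ℂ))) * f x) =
          Complex.exp (-(Complex.I * (dotR x ξ : ℂ))) * (v x ^ p * Q.eval (v x)) * f x := by
        rw [Polynomial.eval_eq_sum_range, Finset.mul_sum, Finset.mul_sum, Finset.sum_mul]
        refine Finset.sum_congr rfl fun j _ => ?_
        rw [hshift, pow_add]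
        ring
      rw [this]
      ring
    simp only [hpt]
    rw [integral_sub (hint ξ) (integrable_finsetSum _ fun j _ => (hint _).const_mul _)]
    ring
  rw [hmain]
  refine (norm_add_le _ _).trans (add_le_add ?_ ?_)
  · refine (norm_integral_le_integral_norm _).trans_eq ?_
    refine integral_congr_ae (Filter.Eventually.of_forall fun x => ?_)
    simp only [norm_mul, norm_exp_neg_I_mul, one_mul, hv]
  · refine (norm_sum_le _ _).trans_eq ?_
    simp only [norm_mul]

/-- Quantitative uncertainty principle: an integrable function and its integrable Fourier
transform cannot both be almost entirely concentrated on a ball. -/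
lemma exists_uncertainty_const {N : ℕ} (i : Fin N) {R : ℝ} (hR : 0 < R) :
    ∃ c : ℝ, 0 < c ∧ ∀ f : RN N → ℂ, Continuous f → Integrable f → Integrable (ftr f) →
      c * (∫ x, ‖f x‖) ≤ (∫ x in (Metric.closedBall 0 R)ᶜ, ‖f x‖) ∨
      c * (∫ x, ‖ftr f x‖) ≤ (∫ x in (Metric.closedBall 0 R)ᶜ, ‖ftr f x‖) := by
  set S : Set (RN N) := Metric.closedBall 0 R with hS
  have hSm : MeasurableSet S := measurableSet_closedBall
  have hSfin : volume S ≠ ∞ := (isCompact_closedBall 0 R).measure_ne_top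
  set V : ℝ := volume.real S with hV
  have hV0 : 0 ≤ V := measureReal_nonneg
  set c₀ : ℝ := ((2 * Real.pi) ^ N)⁻¹ with hc₀
  have hc₀0 : 0 ≤ c₀ := by positivity
  set η : ℝ := 1 / (2 * R) with hη
  have hη0 : 0 < η := by positivity
  obtain ⟨p, hp⟩ := exists_nat_gt (2 * R / η)
  have hp' : 2 * R < p * η := by rwa [div_lt_iff₀ hη0] at hp
  set ε : ℝ := 1 / (2 * (V * V * c₀ + 1)) with hε
  have hε0 : 0 < ε := by positivity
  obtain ⟨Q, hQ⟩ := exists_polynomial_mul_pow_near_one p hε0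
  set q : ℝ := ∑ j ∈ Finset.range (Q.natDegree + 1), ‖Q.coeff j‖ with hq
  have hq0 : 0 ≤ q := by positivity
  set D : ℝ := 1 + q with hD
  set v : RN N → ℂ := fun x => Complex.exp (-(Complex.I * ((η * x i : ℝ) : ℂ))) with hv
  have hvn : ∀ x, ‖v x‖ = 1 := fun x => norm_exp_neg_I_mul _
  set P : RN N → ℝ := fun x => ‖1 - v x ^ p * Q.eval (v x)‖ with hP
  have hPc : Continuous P := by
    have := Q.continuous
    fun_prop
  have hPD : ∀ x, P x ≤ D := by
    intro x
    refine (norm_sub_le _ _).trans ?_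
    rw [norm_one, norm_mul, norm_pow, hvn, one_pow, one_mul, Polynomial.eval_eq_sum_range]
    refine add_le_add le_rfl ((norm_sum_le _ _).trans_eq ?_)
    simp [hvn, hq]
  have hPε : ∀ x ∈ S, P x ≤ ε := by
    intro x hx
    refine hQ _ ?_
    have h1 : |x i| ≤ R := (norm_le_pi_norm x i).trans (mem_closedBall_zero_iff.1 hx)
    have h2 : ‖Complex.exp (Complex.I * ((-(η * x i) : ℝ) : ℂ)) - 1‖ ≤ ‖-(η * x i)‖ :=
      Real.norm_exp_I_mul_ofReal_sub_one_le
    have h3 : v x = Complex.exp (Complex.I * ((-(η * x i) : ℝ) : ℂ)) := by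
      rw [hv]; simp
    rw [norm_sub_rev, h3]
    refine h2.trans ?_
    rw [norm_neg, norm_mul, Real.norm_eq_abs, Real.norm_eq_abs, abs_of_pos hη0]
    calc η * |x i| ≤ η * R := by gcongr
      _ = 1 / 2 := by rw [hη]; field_simp
  set C₁ : ℝ := 2 * (1 + q) with hC₁
  set C₂ : ℝ := 2 * (V * (ε + D)) with hC₂
  have hD0 : 0 ≤ D := by positivity
  have hC₂0 : 0 ≤ C₂ := by positivity
  set T : ℝ := C₁ + 2 * C₂ * V * c₀ + 1 with hT
  have hT2 : 2 ≤ T := by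
    have : 0 ≤ 2 * C₂ * V * c₀ := by positivity
    linarith
  refine ⟨1 / (2 * T), by positivity, fun f hc hf hF => ?_⟩
  set A := ∫ x, ‖f x‖ with hA
  set B := ∫ x, ‖ftr f x‖ with hB
  set A' := ∫ x in Sᶜ, ‖f x‖ with hA'
  set B' := ∫ x in Sᶜ, ‖ftr f x‖ with hB'
  have hA0 : 0 ≤ A := integral_nonneg fun _ => norm_nonneg _
  have hB0 : 0 ≤ B := integral_nonneg fun _ => norm_nonneg _
  have hA'0 : 0 ≤ A' := integral_nonneg fun _ => norm_nonneg _
  have hB'0 : 0 ≤ B' := integral_nonneg fun _ => norm_nonneg _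
  have hAsplit : (∫ x in S, ‖f x‖) + A' = A := integral_add_compl hSm hf.norm
  have hBsplit : (∫ x in S, ‖ftr f x‖) + B' = B := integral_add_compl hSm hF.norm
  have hAin : (∫ x in S, ‖f x‖) ≤ V * (c₀ * B) := by
    calc (∫ x in S, ‖f x‖) ≤ ∫ x in S, c₀ * B :=
          setIntegral_mono hf.norm.integrableOn (integrableOn_const hSfin) fun x =>
            norm_le_integral_ftr hc hf hF x
      _ = V * (c₀ * B) := by rw [setIntegral_const, smul_eq_mul]
  have hPf : Integrable fun x => P x * ‖f x‖ :=
    hf.norm.bdd_mul (c := D) hPc.aestronglyMeasurable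
      (Filter.Eventually.of_forall fun x => by
        rw [Real.norm_eq_abs, abs_of_nonneg (norm_nonneg _)]; exact hPD x)
  have hPint : (∫ x, P x * ‖f x‖) ≤ ε * A + D * A' := by
    rw [← integral_add_compl hSm hPf]
    refine add_le_add ?_ ?_
    · calc (∫ x in S, P x * ‖f x‖) ≤ ∫ x in S, ε * ‖f x‖ :=
            setIntegral_mono_on hPf.integrableOn (hf.norm.const_mul ε).integrableOn hSm
              fun x hx => by
                have := hPε x hx
                gcongr
        _ = ε * ∫ x in S, ‖f x‖ := integral_const_mul _ _
        _ ≤ ε * A := by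
            gcongr
            linarith
    · calc (∫ x in Sᶜ, P x * ‖f x‖) ≤ ∫ x in Sᶜ, D * ‖f x‖ :=
            setIntegral_mono hPf.integrableOn (hf.norm.const_mul D).integrableOn
              fun x => by
                have := hPD x
                simp only
                gcongr
        _ = D * A' := integral_const_mul _ _
  have hshift : ∀ j : ℕ, (∫ ξ in S, ‖ftr f (ξ + Pi.single i (((p + j : ℕ) : ℝ) * η))‖) ≤ B' := by
    intro j
    rw [hB', ← integral_indicator hSm, ← integral_indicator hSm.compl,
      ← integral_add_right_eq_self (Sᶜ.indicator fun x => ‖ftr f x‖)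
        (Pi.single i (((p + j : ℕ) : ℝ) * η))]
    refine integral_mono_of_nonneg (Filter.Eventually.of_forall fun ξ =>
      Set.indicator_nonneg (fun _ _ => norm_nonneg _) _)
      ((hF.norm.indicator hSm.compl).comp_add_right _) (Filter.Eventually.of_forall fun ξ => ?_)
    by_cases hξ : ξ ∈ S
    · have hout : ξ + Pi.single i (((p + j : ℕ) : ℝ) * η) ∈ Sᶜ := by
        intro hmem
        have h1 : |ξ i| ≤ R := (norm_le_pi_norm ξ i).trans (mem_closedBall_zero_iff.1 hξ)
        have h2 := (norm_le_pi_norm _ i).trans (mem_closedBall_zero_iff.1 hmem)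
        rw [Pi.add_apply, Pi.single_eq_same, Real.norm_eq_abs] at h2
        have h3 : (p : ℝ) * η ≤ ((p + j : ℕ) : ℝ) * η := by
          gcongr
          omega
        have h4 := abs_le.1 h1
        have h5 := abs_le.1 h2
        linarith
      simp only [Set.indicator_of_mem hξ, Set.indicator_of_mem hout, le_refl]
    · simp only [Set.indicator_of_notMem hξ]
      exact Set.indicator_nonneg (fun _ _ => norm_nonneg _) _
  have hconst : Integrable (fun _ : RN N => ε * A + D * A') (volume.restrict S) :=
    integrableOn_const hSfin
  have hsh_int : ∀ j : ℕ, Integrable (fun ξ => ‖Q.coeff j‖ *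
      ‖ftr f (ξ + Pi.single i (((p + j : ℕ) : ℝ) * η))‖) (volume.restrict S) := fun j =>
    ((hF.norm.comp_add_right _).const_mul _).integrableOn
  have hBin : (∫ x in S, ‖ftr f x‖) ≤ V * (ε * A + D * A') + q * B' := by
    calc (∫ x in S, ‖ftr f x‖)
        ≤ ∫ ξ in S, ((ε * A + D * A') + ∑ j ∈ Finset.range (Q.natDegree + 1), ‖Q.coeff j‖ *
            ‖ftr f (ξ + Pi.single i (((p + j : ℕ) : ℝ) * η))‖) := by
          refine setIntegral_mono hF.norm.integrableOn (hconst.add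
            (integrable_finsetSum _ fun j _ => hsh_int j)) fun ξ => ?_
          exact (ftr_shift_le i η p Q hf ξ).trans (add_le_add hPint le_rfl)
      _ = V * (ε * A + D * A') + ∑ j ∈ Finset.range (Q.natDegree + 1), ‖Q.coeff j‖ *
            ∫ ξ in S, ‖ftr f (ξ + Pi.single i (((p + j : ℕ) : ℝ) * η))‖ := by
          rw [integral_add hconst
            (integrable_finsetSum _ fun j _ => hsh_int j), setIntegral_const, smul_eq_mul,
            integral_finsetSum _ fun j _ => hsh_int j]
          simp only [integral_const_mul]
          rfl
      _ ≤ _ := by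
          rw [hq, Finset.sum_mul]
          gcongr with j _
          exact hshift j
  by_contra! hcon
  obtain ⟨h1, h2⟩ := hcon
  have hBpos : 0 < B := by
    by_contra hB1
    have : B = 0 := le_antisymm (not_lt.1 hB1) hB0
    rw [this, mul_zero] at h2
    linarith
  have hc4 : 1 / (2 * T) ≤ 1 / 2 := by
    apply one_div_le_one_div_of_le <;> linarith
  have hA2 : A ≤ 2 * V * c₀ * B := by
    have : 1 / (2 * T) * A ≤ 1 / 2 * A := by gcongr
    linarith
  have hεV : V * (ε * (V * (c₀ * B))) ≤ B / 2 := by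
    have : V * (ε * (V * (c₀ * B))) = (V * V * c₀) / (V * V * c₀ + 1) * (B / 2) := by
      rw [hε]; field_simp
    rw [this]
    refine mul_le_of_le_one_left (by positivity) ?_
    rw [div_le_one (by positivity)]
    linarith
  have hB3 : B ≤ C₁ * B' + C₂ * A' := by
    have h5 : V * (ε * A) ≤ V * (ε * (A' + V * (c₀ * B))) := by gcongr; linarith
    rw [hC₁, hC₂]
    linarith
  have hB4 : B ≤ (C₁ + 2 * C₂ * V * c₀) * (1 / (2 * T)) * B := by
    have h5 : C₁ * B' ≤ C₁ * (1 / (2 * T) * B) := by gcongr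
    have h6 : C₂ * A' ≤ C₂ * (1 / (2 * T) * (2 * V * c₀ * B)) := by
      gcongr
      refine h1.le.trans ?_
      gcongr
    linarith
  have h7 : (C₁ + 2 * C₂ * V * c₀) * (1 / (2 * T)) ≤ 1 / 2 := by
    rw [mul_one_div, div_le_iff₀ (by positivity)]
    linarith
  have h8 := mul_le_mul_of_nonneg_right h7 hBpos.le
  linarith

/-- If a fixed proportion of the mass lies outside a ball, increasing the weight increases the
weighted norm exponentially. -/
lemma wInt_le_of_mass_outside {N : ℕ} (W : WeightFunction) {R c ν : ℝ} (hR : 0 ≤ R) (hc : 0 < c)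
    (hν : 0 ≤ ν) {f : RN N → ℂ} (hf : Integrable f)
    (hw : ∀ ν : ℝ, 0 ≤ ν → Integrable fun x => Real.exp (ν * W.w ‖x‖) * ‖f x‖)
    (h : c * (∫ x, ‖f x‖) ≤ ∫ x in (Metric.closedBall 0 R)ᶜ, ‖f x‖) {δ : ℝ} (hδ : 0 ≤ δ) :
    wInt W ν f ≤ (Real.exp (ν * W.w R) / c + 1) *
      (Real.exp (-(δ * W.w R)) * wInt W (ν + δ) f) := by
  set S : Set (RN N) := Metric.closedBall 0 R with hS
  have hSm : MeasurableSet S := measurableSet_closedBall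
  have hi := hw ν hν
  set O := ∫ x in Sᶜ, Real.exp (ν * W.w ‖x‖) * ‖f x‖ with hO
  have hO0 : 0 ≤ O := integral_nonneg fun _ => by positivity
  have hsplit : (∫ x in S, Real.exp (ν * W.w ‖x‖) * ‖f x‖) + O = wInt W ν f :=
    integral_add_compl hSm hi
  have hin : (∫ x in S, Real.exp (ν * W.w ‖x‖) * ‖f x‖) ≤ Real.exp (ν * W.w R) * ∫ x, ‖f x‖ := by
    calc (∫ x in S, Real.exp (ν * W.w ‖x‖) * ‖f x‖)
        ≤ ∫ x in S, Real.exp (ν * W.w R) * ‖f x‖ := by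
          refine setIntegral_mono_on hi.integrableOn (hf.norm.const_mul _).integrableOn hSm
            fun x hx => ?_
          have := W.mono (norm_nonneg x) hR (mem_closedBall_zero_iff.1 hx)
          gcongr
      _ ≤ ∫ x, Real.exp (ν * W.w R) * ‖f x‖ :=
          setIntegral_le_integral (hf.norm.const_mul _)
            (Filter.Eventually.of_forall fun x => by positivity)
      _ = _ := integral_const_mul _ _
  have hout : (∫ x in Sᶜ, ‖f x‖) ≤ O := by
    refine setIntegral_mono hf.norm.integrableOn hi.integrableOn fun x => ?_
    have := W.nonneg ‖x‖
    exact le_mul_of_one_le_left (norm_nonneg _) (Real.one_le_exp (by positivity))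
  have hmass : (∫ x, ‖f x‖) ≤ O / c := by
    rw [le_div_iff₀ hc]
    linarith
  have hgrow : O ≤ Real.exp (-(δ * W.w R)) * wInt W (ν + δ) f := by
    have hi' := hw (ν + δ) (by positivity)
    calc O ≤ ∫ x in Sᶜ, Real.exp (-(δ * W.w R)) * (Real.exp ((ν + δ) * W.w ‖x‖) * ‖f x‖) := by
          refine setIntegral_mono_on hi.integrableOn (hi'.const_mul _).integrableOn hSm.compl
            fun x hx => ?_
          have hx' : R ≤ ‖x‖ := by
            by_contra hlt
            exact hx (mem_closedBall_zero_iff.2 (not_le.1 hlt).le)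
          have := mul_le_mul_of_nonneg_left (W.mono hR (norm_nonneg x) hx') hδ
          rw [← mul_assoc, ← Real.exp_add]
          gcongr
          linarith
      _ ≤ ∫ x, Real.exp (-(δ * W.w R)) * (Real.exp ((ν + δ) * W.w ‖x‖) * ‖f x‖) :=
          setIntegral_le_integral (hi'.const_mul _)
            (Filter.Eventually.of_forall fun x => by positivity)
      _ = _ := integral_const_mul _ _
  calc wInt W ν f ≤ Real.exp (ν * W.w R) * (O / c) + O := by
        rw [← hsplit]
        gcongr
        exact hin.trans (by gcongr)
    _ = (Real.exp (ν * W.w R) / c + 1) * O := by ring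
    _ ≤ _ := by gcongr

lemma BeurlingClass.exists_wInt_mul_le {N : ℕ} (W : WeightFunction) {R : ℝ} (hR : 0 ≤ R)
    (hNR : 0 < N → 0 < R) (hN : N = 0 → R = 0) {ν : ℝ} (hν : 0 ≤ ν) :
    ∃ C : ℝ, 0 ≤ C ∧ ∀ f : RN N → ℂ, BeurlingClass W f → ∀ δ : ℝ, 0 ≤ δ →
      wInt W ν f * wInt W ν (ftr f) ≤ C * (Real.exp (-(δ * W.w R)) *
        (wInt W (ν + δ) f * wInt W (ν + δ) (ftr f))) := by
  rcases Nat.eq_zero_or_pos N with h0 | hpos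
  · have hR0 := hN h0
    subst h0
    refine ⟨1, zero_le_one, fun f hf δ hδ => ?_⟩
    have h1 : wInt W ν f = Real.exp (-(δ * W.w R)) * wInt W (ν + δ) f := by
      rw [wInt, wInt, ← integral_const_mul]
      refine integral_congr_ae (Filter.Eventually.of_forall fun x => ?_)
      have hx : ‖x‖ = 0 := by rw [Subsingleton.elim x 0, norm_zero]
      simp only [hx, hR0]
      rw [← mul_assoc, ← Real.exp_add]
      ring_nf
    have h2 := wInt_mono W (show ν ≤ ν + δ by linarith) (hf.weighted_ftr (ν + δ) (by positivity))
    have h3 := wInt_nonneg W (ν + δ) f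
    rw [h1, one_mul, ← mul_assoc]
    gcongr
  · obtain ⟨c, hc, hunc⟩ := exists_uncertainty_const (⟨0, hpos⟩ : Fin N) (hNR hpos)
    refine ⟨Real.exp (ν * W.w R) / c + 1, by positivity, fun f hf δ hδ => ?_⟩
    have h1 := wInt_mono W (show ν ≤ ν + δ by linarith) (hf.weighted (ν + δ) (by positivity))
    have h2 := wInt_mono W (show ν ≤ ν + δ by linarith) (hf.weighted_ftr (ν + δ) (by positivity))
    have h3 := wInt_nonneg W ν f
    have h4 := wInt_nonneg W ν (ftr f)
    have h5 := wInt_nonneg W (ν + δ) f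
    have h6 := wInt_nonneg W (ν + δ) (ftr f)
    rcases hunc f hf.continuous hf.integrable hf.integrable_ftr with h | h
    · have := wInt_le_of_mass_outside W hR hc hν hf.integrable hf.weighted h hδ
      calc _ ≤ _ := mul_le_mul this h2 h4 (by positivity)
        _ = _ := by ring
    · have := wInt_le_of_mass_outside W hR hc hν hf.integrable_ftr hf.weighted_ftr h hδ
      calc _ ≤ _ := mul_le_mul h1 this h4 (by positivity)
        _ = _ := by ring

lemma eLpNorm_comp_rescale {N : ℕ} {φ : RN N → ℝ} (hφ : Continuous φ) (tbar : RN N) {r : ℝ}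
    (hr : 0 < r) :
    eLpNorm (fun t => φ (r⁻¹ • (t - tbar))) 2 volume =
      ENNReal.ofReal (r ^ ((N : ℝ) / 2)) * eLpNorm φ 2 volume := by
  have hr' : r⁻¹ ≠ 0 := by positivity
  have h1 : eLpNorm (fun t => φ (r⁻¹ • (t - tbar))) 2 volume =
      eLpNorm (fun t => φ (r⁻¹ • t)) 2 (volume : Measure (RN N)) :=
    eLpNorm_comp_measurePreserving (g := fun t : RN N => φ (r⁻¹ • t))
      (Continuous.aestronglyMeasurable (by fun_prop)) (measurePreserving_sub_right volume tbar)
  have h2 : eLpNorm (fun t => φ (r⁻¹ • t)) 2 (volume : Measure (RN N)) =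
      eLpNorm φ 2 (Measure.map (fun t : RN N => r⁻¹ • t) volume) :=
    (eLpNorm_map_measure hφ.aestronglyMeasurable (by fun_prop)).symm
  rw [h1, h2, Measure.map_addHaar_smul volume hr', eLpNorm_smul_measure_of_ne_top (by simp),
    Module.finrank_fin_fun, smul_eq_mul]
  congr 1
  rw [ENNReal.ofReal_rpow_of_pos (by positivity), abs_of_pos (by positivity)]
  congr 1
  rw [inv_pow, inv_inv, ← Real.rpow_natCast, ← Real.rpow_mul hr.le]
  congr 1
  simp
  ring

/-- Price's inequality. -/
lemma exists_price_const {N : ℕ} {α : ℝ} (hα : (N : ℝ) / 2 < α) (tbar : RN N) :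
    ∃ C : ℝ≥0∞, C ≠ ∞ ∧ ∀ h : RN N → ℝ, Continuous h →
      eLpNorm h 1 volume ≤ C * (eLpNorm h 2 volume ^ (1 - (N : ℝ) / (2 * α)) *
        eLpNorm (fun t => ‖t - tbar‖ ^ α * h t) 2 volume ^ ((N : ℝ) / (2 * α))) := by
  rcases Nat.eq_zero_or_pos N with h0 | hN
  · subst h0
    refine ⟨1, one_ne_top, fun h hh => ?_⟩
    have : IsProbabilityMeasure (volume : Measure (RN 0)) := ⟨by
      rw [volume_pi, Measure.pi_of_empty]; simp⟩
    simpa using eLpNorm_le_eLpNorm_of_exponent_le (one_le_two) hh.aestronglyMeasurable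
  have hN' : (0 : ℝ) < N := by exact_mod_cast hN
  have hα0 : 0 < α := by linarith [div_pos hN' two_pos]
  set θ : ℝ := (N : ℝ) / (2 * α) with hθ
  have hθ0 : 0 < θ := by positivity
  have hθ1 : θ < 1 := by rw [hθ, div_lt_one (by positivity)]; linarith
  have hα1 : 0 ≤ α := hα0.le
  set φ : RN N → ℝ := fun t => (1 + ‖t‖) ^ (-α) with hφ
  have hφc : Continuous φ := by
    refine Continuous.rpow_const (by fun_prop) fun t => Or.inl ?_
    positivity
  have hφ2 : MemLp φ 2 (volume : Measure (RN N)) := by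
    rw [memLp_two_iff_integrable_sq hφc.aestronglyMeasurable]
    have := integrable_one_add_norm (E := RN N) (μ := volume) (r := 2 * α)
      (by rw [Module.finrank_fin_fun]; linarith)
    refine this.congr (Filter.Eventually.of_forall fun t => ?_)
    simp only [hφ]
    rw [← Real.rpow_natCast, ← Real.rpow_mul (by positivity)]
    congr 1
    push_cast; ring
  set c := eLpNorm φ 2 (volume : Measure (RN N)) with hc
  refine ⟨c * ENNReal.ofReal (2 ^ α) * 2, ?_, fun h hh => ?_⟩
  · exact mul_ne_top (mul_ne_top hφ2.eLpNorm_ne_top ofReal_ne_top) (by simp)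
  set a := eLpNorm h 2 volume with ha
  set b := eLpNorm (fun t => ‖t - tbar‖ ^ α * h t) 2 volume with hb
  have hwc : Continuous fun t : RN N => ‖t - tbar‖ ^ α * h t :=
    (Continuous.rpow_const (by fun_prop) fun t => Or.inr hα1).mul hh
  have hzero : h =ᵐ[volume] 0 → eLpNorm h 1 volume = 0 := fun h1 =>
    (eLpNorm_eq_zero_iff hh.aestronglyMeasurable one_ne_zero).2 h1
  by_cases ha0 : a = 0
  · rw [hzero ((eLpNorm_eq_zero_iff hh.aestronglyMeasurable two_ne_zero).1 ha0)]
    exact zero_le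
  by_cases hb0 : b = 0
  · have h1 := (eLpNorm_eq_zero_iff hwc.aestronglyMeasurable two_ne_zero).1 hb0
    have : Nonempty (Fin N) := ⟨⟨0, hN⟩⟩
    have h2 : ∀ᵐ t : RN N, t ≠ tbar := Measure.ae_ne volume tbar
    rw [hzero]
    · exact zero_le
    · filter_upwards [h1, h2] with t ht ht'
      have : 0 < ‖t - tbar‖ ^ α := Real.rpow_pos_of_pos (norm_pos_iff.2 (sub_ne_zero.2 ht')) _
      simpa [this.ne'] using ht
  have hC0 : c * ENNReal.ofReal (2 ^ α) * 2 ≠ 0 := by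
    refine mul_ne_zero (mul_ne_zero ?_ ?_) two_ne_zero
    · rw [hc, Ne, eLpNorm_eq_zero_iff hφc.aestronglyMeasurable two_ne_zero]
      intro h1
      have h2 := (Continuous.ae_eq_iff_eq volume hφc continuous_zero).1 h1
      have h3 := congrFun h2 0
      simp [hφ] at h3
    · rw [Ne, ENNReal.ofReal_eq_zero, not_le]; positivity
  have hθ1' : 0 < 1 - θ := by linarith
  by_cases hat : a = ∞
  · rw [hat, top_rpow_of_pos hθ1', top_mul, mul_top hC0]
    · exact le_top
    · simp [ENNReal.rpow_eq_zero_iff, hb0, hθ0.not_gt]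
  by_cases hbt : b = ∞
  · rw [hbt, top_rpow_of_pos hθ0, mul_top, mul_top hC0]
    · exact le_top
    · simp [ENNReal.rpow_eq_zero_iff, ha0, hθ1.not_gt]
  set A := a.toReal with hA
  set B := b.toReal with hB
  have hA0 : 0 < A := toReal_pos ha0 hat
  have hB0 : 0 < B := toReal_pos hb0 hbt
  have hAa : ENNReal.ofReal A = a := ofReal_toReal hat
  have hBb : ENNReal.ofReal B = b := ofReal_toReal hbt
  set r : ℝ := (B / A) ^ (1 / α) with hr
  have hr0 : 0 < r := by positivity
  have hrα : r ^ α = B / A := by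
    rw [hr, ← Real.rpow_mul (by positivity), one_div, inv_mul_cancel₀ hα0.ne', Real.rpow_one]
  set φr : RN N → ℝ := fun t => φ (r⁻¹ • (t - tbar)) with hφr
  set ψ : RN N → ℝ := fun t => (1 + ‖r⁻¹ • (t - tbar)‖) ^ α * h t with hψ
  have hψc : Continuous ψ := by
    refine (Continuous.rpow_const (by fun_prop) fun t => Or.inr hα1).mul hh
  have hφrc : Continuous φr := by fun_prop
  have hprod : h = φr • ψ := by
    funext t
    have h1 : 0 < 1 + ‖r⁻¹ • (t - tbar)‖ := by positivity
    simp only [Pi.smul_apply', smul_eq_mul, hφr, hψ, hφ]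
    rw [← mul_assoc, ← Real.rpow_add h1]
    simp
  have hψle : eLpNorm ψ 2 volume ≤ ENNReal.ofReal (2 ^ α) * (2 * a) := by
    have h1 : ∀ t, ‖ψ t‖ ≤ ‖((2 : ℝ) ^ α • ((fun t => |h t|) +
        (A / B) • fun t => |‖t - tbar‖ ^ α * h t|)) t‖ := by
      intro t
      set s := ‖t - tbar‖ with hs
      have hs0 : 0 ≤ s := norm_nonneg _
      have h2 : ‖r⁻¹ • (t - tbar)‖ = s / r := by
        rw [norm_smul, norm_inv, Real.norm_eq_abs, abs_of_pos hr0, ← hs, inv_mul_eq_div]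
      have h3 : (1 + s / r) ^ α ≤ 2 ^ α * (1 + A / B * s ^ α) := by
        have h4 : 1 + s / r ≤ 2 * max 1 (s / r) := by
          linarith [le_max_left 1 (s / r), le_max_right 1 (s / r)]
        have h5 : (s / r) ^ α = A / B * s ^ α := by
          rw [Real.div_rpow hs0 hr0.le, hrα]; field_simp
        have h6 : 0 ≤ A / B * s ^ α := by positivity
        calc (1 + s / r) ^ α ≤ (2 * max 1 (s / r)) ^ α := by gcongr
          _ = 2 ^ α * (max 1 (s / r)) ^ α := Real.mul_rpow (by norm_num) (by positivity)
          _ ≤ 2 ^ α * (1 + A / B * s ^ α) := by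
              gcongr
              rcases max_choice 1 (s / r) with h7 | h7 <;> rw [h7]
              · rw [Real.one_rpow]; linarith
              · rw [h5]; linarith
      have h11 : ‖ψ t‖ = (1 + s / r) ^ α * |h t| := by
        rw [hψ, norm_mul, Real.norm_eq_abs, Real.norm_eq_abs, abs_of_nonneg (by positivity), h2]
      have h12 : ((2 : ℝ) ^ α • ((fun t => |h t|) +
          (A / B) • fun t => |‖t - tbar‖ ^ α * h t|)) t =
          2 ^ α * (|h t| + A / B * (s ^ α * |h t|)) := by
        simp only [Pi.smul_apply, Pi.add_apply, smul_eq_mul, abs_mul, ← hs]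
        rw [abs_of_nonneg (by positivity : 0 ≤ s ^ α)]
      rw [h11, h12, Real.norm_of_nonneg
        (by positivity : 0 ≤ (2 : ℝ) ^ α * (|h t| + A / B * (s ^ α * |h t|)))]
      calc (1 + s / r) ^ α * |h t| ≤ 2 ^ α * (1 + A / B * s ^ α) * |h t| := by gcongr
        _ = _ := by ring
    refine (eLpNorm_mono h1).trans ?_
    rw [eLpNorm_const_smul]
    have h8 : ‖(2 : ℝ) ^ α‖ₑ = ENNReal.ofReal (2 ^ α) :=
      Real.enorm_of_nonneg (by positivity)
    rw [h8]
    gcongr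
    refine (eLpNorm_add_le hh.abs.aestronglyMeasurable
      (hwc.abs.const_smul (A / B)).aestronglyMeasurable one_le_two).trans ?_
    rw [eLpNorm_const_smul, Real.enorm_of_nonneg (by positivity)]
    have h9 : eLpNorm (fun t => |h t|) 2 volume = a := eLpNorm_norm h
    have h10 : eLpNorm (fun t => |‖t - tbar‖ ^ α * h t|) 2 volume = b :=
      eLpNorm_norm fun t => ‖t - tbar‖ ^ α * h t
    rw [h9, h10, ← hBb, ← ofReal_mul (by positivity), div_mul_cancel₀ _ hB0.ne', hAa, two_mul]
  have hholder : eLpNorm h 1 volume ≤ eLpNorm φr 2 volume * eLpNorm ψ 2 volume := by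
    conv_lhs => rw [hprod]
    exact eLpNorm_smul_le_mul_eLpNorm hψc.aestronglyMeasurable hφrc.aestronglyMeasurable
  have hrN : ENNReal.ofReal (r ^ ((N : ℝ) / 2)) * a = a ^ (1 - θ) * b ^ θ := by
    rw [← hAa, ← hBb, ofReal_rpow_of_pos hA0, ofReal_rpow_of_pos hB0, ← ofReal_mul (by positivity),
      ← ofReal_mul (by positivity)]
    congr 1
    have h1 : r ^ ((N : ℝ) / 2) = (B / A) ^ θ := by
      rw [hr, ← Real.rpow_mul (by positivity)]
      congr 1
      rw [hθ]; field_simp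
    rw [h1, Real.div_rpow hB0.le hA0.le, Real.rpow_sub hA0, Real.rpow_one]
    field_simp
  calc eLpNorm h 1 volume ≤ eLpNorm φr 2 volume * eLpNorm ψ 2 volume := hholder
    _ ≤ (ENNReal.ofReal (r ^ ((N : ℝ) / 2)) * c) * (ENNReal.ofReal (2 ^ α) * (2 * a)) := by
        rw [hφr, eLpNorm_comp_rescale hφc tbar hr0]
        gcongr
    _ = (c * ENNReal.ofReal (2 ^ α) * 2) * (ENNReal.ofReal (r ^ ((N : ℝ) / 2)) * a) := by ring
    _ = _ := by rw [hrN]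

/-- A set of positive measure meets a suitable ball in a set of positive measure; in dimension
zero the ball can be taken of radius zero. -/
theorem exists_radius_volume_inter_ne_zero {N : ℕ} {E : Set (RN N × RN N)}
    (hE : volume E ≠ 0) :
    ∃ R : ℝ, 0 ≤ R ∧ (0 < N → 0 < R) ∧ (N = 0 → R = 0) ∧
      volume (E ∩ Metric.closedBall 0 R) ≠ 0 := by
  rcases Nat.eq_zero_or_pos N with rfl | hN
  · refine ⟨0, le_rfl, fun h => absurd h (lt_irrefl 0), fun _ => rfl, ?_⟩
    have h1 : Metric.closedBall (0 : RN 0 × RN 0) 0 = Set.univ :=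
      Set.eq_univ_of_forall fun z => by rw [Subsingleton.elim z 0]; simp
    rwa [h1, Set.inter_univ]
  · by_contra! hcon
    refine hE ?_
    have h1 : E = ⋃ n : ℕ, E ∩ Metric.closedBall 0 ((n : ℝ) + 1) := by
      rw [← Set.inter_iUnion]
      refine (Set.inter_eq_left.2 fun z _ => ?_).symm
      obtain ⟨n, hn⟩ := exists_nat_ge ‖z‖
      exact Set.mem_iUnion.2 ⟨n, by rw [mem_closedBall_zero_iff]; linarith⟩
    rw [h1, measure_iUnion_null_iff]
    intro n
    exact hcon _ (by positivity) (fun _ => by positivity) fun h => absurd h hN.ne'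

theorem WeightFunction.volume_mul_exp_le (W : WeightFunction) {N : ℕ} {E : Set (RN N × RN N)}
    {R μ : ℝ} (hμ : 0 ≤ μ) :
    volume (E ∩ Metric.closedBall 0 R) * ENNReal.ofReal (Real.exp (-(μ * W.w R))) ≤
      ∫⁻ z in E, ENNReal.ofReal (Real.exp (-(μ * W.w ‖z‖))) := by
  calc volume (E ∩ Metric.closedBall 0 R) * ENNReal.ofReal (Real.exp (-(μ * W.w R)))
      = ∫⁻ _ in E ∩ Metric.closedBall 0 R, ENNReal.ofReal (Real.exp (-(μ * W.w R))) := by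
        rw [setLIntegral_const, mul_comm]
    _ ≤ ∫⁻ z in E ∩ Metric.closedBall 0 R, ENNReal.ofReal (Real.exp (-(μ * W.w ‖z‖))) := by
        have hc := W.cont
        refine setLIntegral_mono (by fun_prop) fun z hz => ?_
        have hzR : ‖z‖ ≤ R := mem_closedBall_zero_iff.1 hz.2
        have := W.mono (norm_nonneg z) ((norm_nonneg z).trans hzR) hzR
        gcongr
    _ ≤ _ := lintegral_mono_set Set.inter_subset_left

theorem lintegral_exp_mul_spec_le {N : ℕ} {W : WeightFunction} {f g : RN N → ℂ}
    {E : Set (RN N × RN N)} {lam μ C : ℝ} (hC : 0 ≤ C)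
    (h : ∀ z : RN N × RN N, Real.exp ((lam + μ) * W.w ‖z‖) * spec g f z.1 z.2 ≤ C) :
    ∫⁻ z in E, ENNReal.ofReal (Real.exp (lam * W.w ‖z‖) * spec g f z.1 z.2) ≤
      ENNReal.ofReal C * ∫⁻ z in E, ENNReal.ofReal (Real.exp (-(μ * W.w ‖z‖))) := by
  have hc := W.cont
  rw [← lintegral_const_mul _ (by fun_prop)]
  refine lintegral_mono fun z => ?_
  rw [← ofReal_mul hC]
  refine ofReal_le_ofReal ?_
  calc Real.exp (lam * W.w ‖z‖) * spec g f z.1 z.2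
      = Real.exp ((lam + μ) * W.w ‖z‖) * spec g f z.1 z.2 * Real.exp (-(μ * W.w ‖z‖)) := by
        rw [mul_right_comm, ← Real.exp_add]; ring_nf
    _ ≤ _ := by gcongr; exact h z

theorem BeurlingClass.exists_lintegral_spec_le {N : ℕ} {W : WeightFunction} {g : RN N → ℂ}
    (hg : BeurlingClass W g) (E : Set (RN N × RN N)) {lam : ℝ} (hlam : 0 ≤ lam) :
    ∃ C : ℝ, 0 ≤ C ∧ ∀ μ, 0 ≤ μ → ∀ f : RN N → ℂ, BeurlingClass W f →
      ∫⁻ z in E, ENNReal.ofReal (Real.exp (lam * W.w ‖z‖) * spec g f z.1 z.2) ≤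
        ENNReal.ofReal C * (∫⁻ z in E, ENNReal.ofReal (Real.exp (-(μ * W.w ‖z‖)))) *
          ENNReal.ofReal (wInt W (W.K ^ 2 * (lam + μ)) f *
            wInt W (W.K ^ 2 * (lam + μ)) (ftr f)) := by
  by_cases hE : volume E = 0
  · refine ⟨0, le_rfl, fun μ _ f _ => ?_⟩
    rw [setLIntegral_measure_zero _ _ hE]
    exact zero_le
  obtain ⟨R, hR, hNR, hN, hv0⟩ := exists_radius_volume_inter_ne_zero hE
  have hvt : volume (E ∩ Metric.closedBall 0 R) ≠ ∞ :=
    ((measure_mono Set.inter_subset_right).trans_lt measure_closedBall_lt_top).ne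
  set v := (volume (E ∩ Metric.closedBall 0 R)).toReal with hv
  have hvpos : 0 < v := toReal_pos hv0 hvt
  set d : ℝ := (Module.finrank ℝ (RN N × RN N) : ℝ)
  set μ₁ : ℝ := (d + 1) / W.b with hμ₁
  have hμ₁0 : 0 ≤ μ₁ := div_nonneg (by positivity) W.bpos.le
  have hint : Integrable (fun z : RN N × RN N => Real.exp (-(μ₁ * W.w ‖z‖))) volume := by
    have : (volume : Measure (RN N × RN N)).IsAddHaarMeasure :=
      Measure.prod.instIsAddHaarMeasure volume volume
    refine W.integrable_exp_neg volume ?_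
    rw [hμ₁, div_mul_cancel₀ _ W.bpos.ne']
    exact lt_add_one d
  set I := ∫ z : RN N × RN N, Real.exp (-(μ₁ * W.w ‖z‖)) with hI
  have hI0 : 0 ≤ I := integral_nonneg fun z => (Real.exp_pos _).le
  have hIle : ∫⁻ z in E, ENNReal.ofReal (Real.exp (-(μ₁ * W.w ‖z‖))) ≤ ENNReal.ofReal I := by
    rw [hI, ofReal_integral_eq_lintegral_ofReal hint (.of_forall fun z => (Real.exp_pos _).le)]
    exact setLIntegral_le_lintegral _ _
  obtain ⟨C₁, hC₁, h₁⟩ := hg.exists_spec_le (lam + μ₁) (by positivity)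
  have hν : 0 ≤ W.K ^ 2 * (lam + μ₁) := by positivity
  obtain ⟨C₂, hC₂, h₂⟩ := BeurlingClass.exists_wInt_mul_le W hR hNR hN hν
  set C₃ := C₁ * I * C₂ * Real.exp (μ₁ * W.w R) / v with hC₃
  have hC₃0 : 0 ≤ C₃ := by positivity
  refine ⟨C₁ + C₃, by positivity, fun μ hμ f hf => ?_⟩
  set ν := W.K ^ 2 * (lam + μ) with hνdef
  have hAB : ∀ κ, 0 ≤ wInt W κ f * wInt W κ (ftr f) :=
    fun κ => mul_nonneg (wInt_nonneg ..) (wInt_nonneg ..)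
  set D := ∫⁻ z in E, ENNReal.ofReal (Real.exp (-(μ * W.w ‖z‖))) with hD
  rcases le_total μ μ₁ with hle | hle
  · refine (lintegral_exp_mul_spec_le (mul_nonneg hC₁ (hAB ν))
      (h₁ (lam + μ) (by positivity) (by linarith) f hf)).trans ?_
    rw [ofReal_mul hC₁, mul_right_comm]
    gcongr
    linarith
  · have hδ : 0 ≤ W.K ^ 2 * (μ - μ₁) := mul_nonneg (sq_nonneg _) (by linarith)
    have h₃ := h₂ f hf _ hδ
    rw [← mul_add, show lam + μ₁ + (μ - μ₁) = lam + μ by ring, ← hνdef] at h₃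
    have h₄ : Real.exp (-(W.K ^ 2 * (μ - μ₁) * W.w R)) ≤
        Real.exp (μ₁ * W.w R) * Real.exp (-(μ * W.w R)) := by
      rw [← Real.exp_add]
      refine Real.exp_le_exp.2 ?_
      have h₅ : 1 ≤ W.K ^ 2 := one_le_pow₀ W.oneLeK
      have h₆ : 0 ≤ (μ - μ₁) * W.w R := mul_nonneg (by linarith) (W.nonneg R)
      nlinarith
    have h₇ : ENNReal.ofReal (Real.exp (-(μ * W.w R))) ≤ ENNReal.ofReal v⁻¹ * D := by
      rw [ofReal_inv_of_pos hvpos, hv, ofReal_toReal hvt]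
      calc ENNReal.ofReal (Real.exp (-(μ * W.w R)))
          = (volume (E ∩ Metric.closedBall 0 R))⁻¹ * (volume (E ∩ Metric.closedBall 0 R) *
            ENNReal.ofReal (Real.exp (-(μ * W.w R)))) := by
            rw [← mul_assoc, ENNReal.inv_mul_cancel hv0 hvt, one_mul]
        _ ≤ _ := by gcongr; exact W.volume_mul_exp_le hμ
    calc ∫⁻ z in E, ENNReal.ofReal (Real.exp (lam * W.w ‖z‖) * spec g f z.1 z.2)
        ≤ ENNReal.ofReal (C₁ * (wInt W (W.K ^ 2 * (lam + μ₁)) f *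
            wInt W (W.K ^ 2 * (lam + μ₁)) (ftr f))) *
            ∫⁻ z in E, ENNReal.ofReal (Real.exp (-(μ₁ * W.w ‖z‖))) :=
          lintegral_exp_mul_spec_le (mul_nonneg hC₁ (hAB _))
            (h₁ (lam + μ₁) (by positivity) le_rfl f hf)
      _ ≤ ENNReal.ofReal (C₁ * (C₂ * (Real.exp (μ₁ * W.w R) * Real.exp (-(μ * W.w R)) *
            (wInt W ν f * wInt W ν (ftr f))))) * ENNReal.ofReal I := by
          have := hAB ν
          have h₈ := h₃.trans (mul_le_mul_of_nonneg_left
            (mul_le_mul_of_nonneg_right h₄ this) hC₂)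
          exact mul_le_mul' (ofReal_le_ofReal (mul_le_mul_of_nonneg_left h₈ hC₁)) hIle
      _ = ENNReal.ofReal (C₁ * I * C₂ * Real.exp (μ₁ * W.w R) *
            (wInt W ν f * wInt W ν (ftr f))) * ENNReal.ofReal (Real.exp (-(μ * W.w R))) := by
          have := hAB ν
          rw [← ofReal_mul (by positivity), ← ofReal_mul (by positivity)]
          ring_nf
      _ ≤ ENNReal.ofReal (C₁ * I * C₂ * Real.exp (μ₁ * W.w R) *
            (wInt W ν f * wInt W ν (ftr f))) * (ENNReal.ofReal v⁻¹ * D) := by gcongr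
      _ = ENNReal.ofReal C₃ * D * ENNReal.ofReal (wInt W ν f * wInt W ν (ftr f)) := by
          have := hAB ν
          rw [← mul_assoc, ← ofReal_mul (by positivity), mul_right_comm (ENNReal.ofReal C₃),
            ← ofReal_mul hC₃0, hC₃]
          ring_nf
      _ ≤ _ := by gcongr; linarith

/-- Price's inequality for the weighted `L¹` norm. -/
theorem exists_ofReal_wInt_le {N : ℕ} (W : WeightFunction) {α : ℝ} (hα : (N : ℝ) / 2 < α)
    (tbar : RN N) :
    ∃ C : ℝ, 0 ≤ C ∧ ∀ (ν : ℝ) (f : RN N → ℂ), Continuous f →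
      Integrable (fun t => Real.exp (ν * W.w ‖t‖) * ‖f t‖) →
      ENNReal.ofReal (wInt W ν f) ≤ ENNReal.ofReal C *
        (wnorm W ν volume f 2 ^ (1 - (N : ℝ) / (2 * α)) *
          eLpNorm (fun t : RN N => Real.exp (ν * W.w ‖t‖) * (‖t - tbar‖ ^ α * ‖f t‖)) 2
            volume ^ ((N : ℝ) / (2 * α))) := by
  obtain ⟨C, hC, h⟩ := exists_price_const hα tbar
  refine ⟨C.toReal, toReal_nonneg, fun ν f hf hi => ?_⟩
  have hc := W.cont
  have h1 := h (fun t => Real.exp (ν * W.w ‖t‖) * ‖f t‖) (by fun_prop)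
  rw [ofReal_toReal hC]
  convert h1 using 1
  · rw [eLpNorm_one_eq_lintegral_enorm, wInt,
      ofReal_integral_eq_lintegral_ofReal hi (.of_forall fun t => by positivity)]
    refine lintegral_congr fun t => ?_
    rw [Real.enorm_of_nonneg (by positivity)]
  · simp only [wnorm, mul_left_comm (Real.exp _)]

theorem stmt17 {N : ℕ} (W : WeightFunction) (g : SchwartzMap (RN N) ℂ)
    (hg : SOmega W ⇑g) (hg0 : ⇑g ≠ 0)
    (α : ℝ) (hα : (N : ℝ) / 2 < α) (xbar ξbar : RN N)
    (E : Set (RN N × RN N)) (hE : MeasurableSet E) :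
    ∀ lam : ℝ, 0 ≤ lam → ∃ C : ℝ, 0 < C ∧
      ∀ μ : ℝ, 0 ≤ μ → ∀ f : SchwartzMap (RN N) ℂ, SOmega W ⇑f →
        (∫⁻ z in E, ENNReal.ofReal (Real.exp (lam * W.w ‖z‖) * spec ⇑g ⇑f z.1 z.2)) ≤
          ENNReal.ofReal C *
          (∫⁻ z in E, ENNReal.ofReal (Real.exp (-(μ * W.w ‖z‖)))) *
          (wnorm W (W.K ^ 2 * (lam + μ)) MeasureTheory.volume ⇑f 2) ^
            (1 - (N : ℝ) / (2 * α)) *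
          (MeasureTheory.eLpNorm (fun t : RN N =>
            Real.exp (W.K ^ 2 * (lam + μ) * W.w ‖t‖) * (‖t - xbar‖ ^ α * ‖f t‖)) 2
            MeasureTheory.volume) ^ ((N : ℝ) / (2 * α)) *
          (wnorm W (W.K ^ 2 * (lam + μ)) MeasureTheory.volume (ftr ⇑f) 2) ^
            (1 - (N : ℝ) / (2 * α)) *
          (MeasureTheory.eLpNorm (fun ξ : RN N =>
            Real.exp (W.K ^ 2 * (lam + μ) * W.w ‖ξ‖) * (‖ξ - ξbar‖ ^ α * ‖ftr ⇑f ξ‖)) 2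
            MeasureTheory.volume) ^ ((N : ℝ) / (2 * α)) := by
  intro lam hlam
  obtain ⟨C₀, hC₀, h₀⟩ := hg.beurlingClass.exists_lintegral_spec_le E hlam
  obtain ⟨C₁, hC₁, h₁⟩ := exists_ofReal_wInt_le W hα xbar
  obtain ⟨C₂, hC₂, h₂⟩ := exists_ofReal_wInt_le W hα ξbar
  refine ⟨C₀ * (C₁ * C₂) + 1, by positivity, fun μ hμ f hf => ?_⟩
  have hf' := hf.beurlingClass
  set ν := W.K ^ 2 * (lam + μ)
  have hν : 0 ≤ ν := mul_nonneg (sq_nonneg _) (add_nonneg hlam hμ)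
  refine (h₀ μ hμ f hf').trans ?_
  rw [ofReal_mul (wInt_nonneg ..)]
  refine (mul_le_mul_right (mul_le_mul' (h₁ ν f hf'.continuous (hf'.weighted ν hν))
    (h₂ ν (ftr f) hf'.continuous_ftr (hf'.weighted_ftr ν hν))) _).trans ?_
  have hle : ENNReal.ofReal C₀ * (ENNReal.ofReal C₁ * ENNReal.ofReal C₂) ≤
      ENNReal.ofReal (C₀ * (C₁ * C₂) + 1) := by
    rw [← ofReal_mul hC₁, ← ofReal_mul hC₀]
    exact ofReal_le_ofReal (by linarith)
  refine le_trans (le_of_eq ?_) (mul_le_mul_left (mul_le_mul_left (mul_le_mul_left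
    (mul_le_mul_left (mul_le_mul_left hle _) _) _) _) _)
  ring
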